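/- arXiv:1710.05415 — 3 statements merged into one kernel-verified Lean document; each statement's English description precedes it below -/
import Mathlib

section
/- Let κ₁, ε₁ > 0 and σ₁, σ₂ ∈ ℝ with σ₁·σ₂ ≠ 0. Define ω^e(L) = (1/(4κ₁ε₁))·((σ₁² + σ₂²)·(coth(κ₁L) − 1) + 2σ₁σ₂/sinh(κ₁L)) and ω^s(L) = (σ₁σ₂/(2κ₁ε₁))·exp(−κ₁L) for L > 0. Then ω^e(L)/ω^s(L) tends to 2 as L → ∞. -/
open Real Filter Topology

/-- The hyperbolic cotangent. -/
noncomputable def coth (x : ℝ) : ℝ := Real.cosh x / Real.sinh x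

/-- Asymptotically the exact surface interaction exceeds the superposition
approximation by a factor of two:  ω^e(L)/ω^s(L) → 2 as L → ∞. -/
theorem surface_interaction_ratio_tendsto_two
    (κ₁ ε₁ σ₁ σ₂ : ℝ) (hκ₁ : 0 < κ₁) (hε₁ : 0 < ε₁) (hσ : σ₁ * σ₂ ≠ 0) :
    Tendsto (fun L : ℝ =>
        (1 / (4 * κ₁ * ε₁) *
          ((σ₁ ^ 2 + σ₂ ^ 2) * (coth (κ₁ * L) - 1) +
            2 * σ₁ * σ₂ / Real.sinh (κ₁ * L))) /
        (σ₁ * σ₂ / (2 * κ₁ * ε₁) * Real.exp (-κ₁ * L)))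
      atTop (𝓝 2) := by
  have hp1 : σ₁ ≠ 0 := left_ne_zero_of_mul hσ
  have hp2 : σ₂ ≠ 0 := right_ne_zero_of_mul hσ
  have ht : Tendsto (fun L : ℝ => Real.exp (-κ₁ * L)) atTop (𝓝 0) :=
    Real.tendsto_exp_atBot.comp (tendsto_id.const_mul_atTop_of_neg (neg_lt_zero.mpr hκ₁))
  have hlim : Tendsto (fun L : ℝ =>
      ((σ₁ ^ 2 + σ₂ ^ 2) * Real.exp (-κ₁ * L) + 2 * (σ₁ * σ₂)) /
        (σ₁ * σ₂ * (1 - Real.exp (-κ₁ * L) ^ 2))) atTop (𝓝 2) := by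
    have h := ((ht.const_mul (σ₁ ^ 2 + σ₂ ^ 2)).add_const (2 * (σ₁ * σ₂))).div
      (((ht.pow 2).const_sub 1).const_mul (σ₁ * σ₂)) (by simpa using hσ)
    have h2 : ((σ₁ ^ 2 + σ₂ ^ 2) * 0 + 2 * (σ₁ * σ₂)) / (σ₁ * σ₂ * (1 - 0 ^ 2)) = 2 := by
      rw [div_eq_iff (by simpa using hσ)]
      ring
    rw [h2] at h
    exact h
  refine hlim.congr' ?_
  filter_upwards [eventually_gt_atTop 0] with L hL
  have hx : 0 < κ₁ * L := mul_pos hκ₁ hL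
  have hlt : Real.exp (-κ₁ * L) < 1 := by
    rw [Real.exp_lt_one_iff]
    linarith
  have hpos := Real.exp_pos (-κ₁ * L)
  have he : Real.exp (κ₁ * L) = (Real.exp (-κ₁ * L))⁻¹ := by
    rw [← Real.exp_neg]
    congr 1
    ring
  have he' : Real.exp (-(κ₁ * L)) = Real.exp (-κ₁ * L) := by
    congr 1
    ring
  rw [coth, Real.cosh_eq, Real.sinh_eq, he, he']
  generalize Real.exp (-κ₁ * L) = t at *
  have h1 : 1 - t ^ 2 ≠ 0 := by nlinarith
  have ht0 : t ≠ 0 := hpos.ne'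
  have hs : (t⁻¹ - t) / 2 = (1 - t ^ 2) / (2 * t) := by
    field_simp
  rw [hs]
  field_simp
  ring
end

section
/- Let κ₁, ε₁ > 0 and σ₁, σ₂ ∈ ℝ with σ₁·σ₂ = 0 and (σ₁, σ₂) ≠ (0, 0). Define ω_{γ,1}(L) = (1/(4κ₁ε₁))·((σ₁² + σ₂²)·(coth(κ₁L) − 1) + 2σ₁σ₂/sinh(κ₁L)) for L > 0. Then exp(2κ₁L)·ω_{γ,1}(L) tends to (σ₁² + σ₂²)/(2κ₁ε₁) as L → ∞; in particular ω_{γ,1}(L) decays like exp(−2κ₁L) rather than exp(−κ₁L). -/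
open Real Filter Topology

/-- Finite-size effect: if exactly one wall is uncharged (σ₁σ₂ = 0 but not
both charges zero), the exact surface interaction decays like exp(−2κ₁L):
exp(2κ₁L)·ω_{γ,1}(L) → (σ₁² + σ₂²)/(2κ₁ε₁) as L → ∞. -/
theorem surface_interaction_double_decay
    (κ₁ ε₁ σ₁ σ₂ : ℝ) (hκ₁ : 0 < κ₁) (hε₁ : 0 < ε₁)
    (hσ : σ₁ * σ₂ = 0) (hσ' : (σ₁, σ₂) ≠ (0, 0)) :
    Tendsto (fun L : ℝ =>
        Real.exp (2 * κ₁ * L) *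
          (1 / (4 * κ₁ * ε₁) *
            ((σ₁ ^ 2 + σ₂ ^ 2) * (coth (κ₁ * L) - 1) +
              2 * σ₁ * σ₂ / Real.sinh (κ₁ * L))))
      atTop (𝓝 ((σ₁ ^ 2 + σ₂ ^ 2) / (2 * κ₁ * ε₁))) := by
  have h0 : Tendsto (fun L : ℝ => Real.exp (-(2 * κ₁ * L))) atTop (𝓝 0) :=
    Real.tendsto_exp_neg_atTop_nhds_zero.comp
      (tendsto_id.const_mul_atTop (by positivity : (0 : ℝ) < 2 * κ₁))
  have h1 : Tendsto (fun L : ℝ => (σ₁ ^ 2 + σ₂ ^ 2) / (2 * κ₁ * ε₁) /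
      (1 - Real.exp (-(2 * κ₁ * L)))) atTop (𝓝 ((σ₁ ^ 2 + σ₂ ^ 2) / (2 * κ₁ * ε₁))) := by
    have h := (tendsto_const_nhds (x := (σ₁ ^ 2 + σ₂ ^ 2) / (2 * κ₁ * ε₁)) (f := atTop)).div
      ((tendsto_const_nhds (x := (1 : ℝ))).sub h0) (by norm_num)
    rw [sub_zero, div_one] at h
    exact h
  refine h1.congr' ?_
  filter_upwards [eventually_gt_atTop 0] with L hL
  have hx : 0 < κ₁ * L := mul_pos hκ₁ hL
  have h2 : 2 * σ₁ * σ₂ = 0 := by rw [mul_assoc, hσ, mul_zero]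
  have hE : Real.exp (2 * κ₁ * L) = Real.exp (κ₁ * L) ^ 2 := by
    rw [← Real.exp_nat_mul]; congr 1; push_cast; ring
  have he : 1 < Real.exp (κ₁ * L) := Real.one_lt_exp_iff.mpr hx
  rw [h2, zero_div, add_zero, coth, Real.cosh_eq, Real.sinh_eq, Real.exp_neg, Real.exp_neg, hE]
  generalize Real.exp (κ₁ * L) = E at he
  have hE0 : E ≠ 0 := by positivity
  have h3 : E ^ 2 - 1 ≠ 0 := by nlinarith
  have h4 : E - E⁻¹ = (E ^ 2 - 1) / E := by field_simp
  have h5 : 1 - (E ^ 2)⁻¹ = (E ^ 2 - 1) / E ^ 2 := by field_simp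
  rw [h4, h5]
  field_simp
  ring
end

section
/- Let κ₁, ε₁ > 0 and σ₁, σ₂ ∈ ℝ with (σ₁, σ₂) ≠ (0, 0), and define ω_{γ,1}(L) = (1/(4κ₁ε₁))·((σ₁² + σ₂²)·(coth(κ₁L) − 1) + 2σ₁σ₂/sinh(κ₁L)) for L > 0. Then for L > 0, ω_{γ,1}(L) = 0 if and only if exp(−κ₁L) = −2σ₁σ₂/(σ₁² + σ₂²). Consequently, ω_{γ,1} has a zero on (0, ∞) if and only if σ₁σ₂ < 0 and σ₁ ≠ −σ₂, and in that case the unique zero is at L = −(1/κ₁)·log(−2σ₁σ₂/(σ₁² + σ₂²)). -/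
open Real

/-- Zeros of the exact surface interaction energy density
ω_{γ,1}(L) = (1/(4κ₁ε₁))((σ₁² + σ₂²)(coth(κ₁L) − 1) + 2σ₁σ₂/sinh(κ₁L)):
for L > 0, ω_{γ,1}(L) = 0 iff exp(−κ₁L) = −2σ₁σ₂/(σ₁² + σ₂²); a zero on
(0, ∞) exists iff σ₁σ₂ < 0 and σ₁ ≠ −σ₂, in which case it is unique and
located at L = −(1/κ₁)·log(−2σ₁σ₂/(σ₁² + σ₂²)). -/
theorem surface_interaction_zeros
    (κ₁ ε₁ σ₁ σ₂ : ℝ) (hκ₁ : 0 < κ₁) (hε₁ : 0 < ε₁)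
    (hσ : (σ₁, σ₂) ≠ (0, 0))
    (ω : ℝ → ℝ)
    (hω : ∀ L : ℝ, ω L =
      1 / (4 * κ₁ * ε₁) *
        ((σ₁ ^ 2 + σ₂ ^ 2) * (coth (κ₁ * L) - 1) +
          2 * σ₁ * σ₂ / Real.sinh (κ₁ * L))) :
    (∀ L : ℝ, 0 < L →
      (ω L = 0 ↔ Real.exp (-κ₁ * L) = -(2 * σ₁ * σ₂) / (σ₁ ^ 2 + σ₂ ^ 2))) ∧
    ((∃ L : ℝ, 0 < L ∧ ω L = 0) ↔ (σ₁ * σ₂ < 0 ∧ σ₁ ≠ -σ₂)) ∧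
    (σ₁ * σ₂ < 0 → σ₁ ≠ -σ₂ →
      ∀ L : ℝ, 0 < L →
        (ω L = 0 ↔
          L = -(1 / κ₁) * Real.log (-(2 * σ₁ * σ₂) / (σ₁ ^ 2 + σ₂ ^ 2)))) := by
  have hS : 0 < σ₁ ^ 2 + σ₂ ^ 2 := by
    by_contra h
    apply hσ
    have h1 : σ₁ ^ 2 = 0 := by nlinarith [sq_nonneg σ₁, sq_nonneg σ₂]
    have h2 : σ₂ ^ 2 = 0 := by nlinarith [sq_nonneg σ₁, sq_nonneg σ₂]
    rw [pow_eq_zero_iff two_ne_zero] at h1 h2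
    rw [h1, h2]
  have key : ∀ L : ℝ, 0 < L →
      (ω L = 0 ↔ Real.exp (-κ₁ * L) = -(2 * σ₁ * σ₂) / (σ₁ ^ 2 + σ₂ ^ 2)) := by
    intro L hL
    have hs : 0 < Real.sinh (κ₁ * L) := Real.sinh_pos_iff.mpr (mul_pos hκ₁ hL)
    have he : Real.exp (-κ₁ * L) = Real.cosh (κ₁ * L) - Real.sinh (κ₁ * L) := by
      rw [Real.cosh_sub_sinh, neg_mul]
    have h1 : ω L = ((σ₁ ^ 2 + σ₂ ^ 2) * Real.exp (-κ₁ * L) + 2 * σ₁ * σ₂) /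
        (4 * κ₁ * ε₁ * Real.sinh (κ₁ * L)) := by
      rw [hω, he, coth]
      field_simp
    have h2 : 4 * κ₁ * ε₁ * Real.sinh (κ₁ * L) ≠ 0 := by positivity
    rw [h1, div_eq_zero_iff, or_iff_left h2, eq_div_iff hS.ne']
    constructor <;> intro h <;> linarith
  have key2 : σ₁ * σ₂ < 0 → ∀ L : ℝ,
      (Real.exp (-κ₁ * L) = -(2 * σ₁ * σ₂) / (σ₁ ^ 2 + σ₂ ^ 2) ↔
        L = -(1 / κ₁) * Real.log (-(2 * σ₁ * σ₂) / (σ₁ ^ 2 + σ₂ ^ 2))) := by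
    intro h L
    have hr : 0 < -(2 * σ₁ * σ₂) / (σ₁ ^ 2 + σ₂ ^ 2) := div_pos (by linarith) hS
    constructor
    · intro h
      rw [← h, Real.log_exp]
      field_simp
    · intro h
      rw [← Real.exp_log hr]
      congr 1
      rw [h]
      field_simp
  refine ⟨key, ⟨?_, ?_⟩, fun h _ L hL => (key L hL).trans (key2 h L)⟩
  · rintro ⟨L, hL, h⟩
    rw [key L hL] at h
    have h0 := Real.exp_pos (-κ₁ * L)
    have h1 : Real.exp (-κ₁ * L) < 1 := Real.exp_lt_one_iff.mpr (by nlinarith)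
    rw [h] at h0 h1
    rw [div_lt_one hS] at h1
    have h2 := (div_pos_iff_of_pos_right hS).mp h0
    refine ⟨by linarith, fun h3 => ?_⟩
    rw [h3] at h1
    nlinarith
  · rintro ⟨h, hne⟩
    have hr : 0 < -(2 * σ₁ * σ₂) / (σ₁ ^ 2 + σ₂ ^ 2) := div_pos (by linarith) hS
    have hr1 : -(2 * σ₁ * σ₂) / (σ₁ ^ 2 + σ₂ ^ 2) < 1 := by
      rw [div_lt_one hS]
      have : σ₁ + σ₂ ≠ 0 := fun h => hne (by linarith)
      have := sq_pos_of_ne_zero this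
      nlinarith
    have hL : 0 < -(1 / κ₁) * Real.log (-(2 * σ₁ * σ₂) / (σ₁ ^ 2 + σ₂ ^ 2)) :=
      mul_pos_of_neg_of_neg (by simpa using hκ₁) (Real.log_neg hr hr1)
    exact ⟨_, hL, (key _ hL).mpr ((key2 h _).mpr rfl)⟩
end
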